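/- Let r > 0 and set r⃗ = (r,0). Define the iteration u⁽⁰⁾ = (0,0) and, for n ≥ 1, u₁⁽ⁿ⁾ = inf{t : f^{1,1}(t−) + f^{1,2}(u₂⁽ⁿ⁻¹⁾−) = −r} and u₂⁽ⁿ⁾ = inf{t : f^{2,2}(t−) + f^{2,1}(u₁⁽ⁿ⁻¹⁾−) = 0} = τ²(f^{2,1}(u₁⁽ⁿ⁻¹⁾−)). Assume (as holds by the construction of first hitting times) that u⁽ⁿ⁾ is componentwise nondecreasing in n, and let T = (T₁, T₂) = lim_{n→∞} u⁽ⁿ⁾ ∈ [0,∞]². Then T₁ = inf{ t : f^{1,1}(t−) + f^{1,2}_−( τ²( f^{2,1}(t−) ) ) = −r } and T₂ = τ²( f^{2,1}(T₁−) ), where g_−(t) := g(t−). -/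

import Mathlib

open Filter Topology Set
open scoped NNReal ENNReal

/-- For a nondecreasing nonnegative function `f` on `ℝ≥0` with `f 0 = 0`, its
left-limit function extended to arguments in `[0,∞]`:
`extLeft f x = f(x−) = sup_{s < x} f s` (with `f(0−) = 0 = f 0` and
`f(∞−) = lim_{t→∞} f t ∈ [0,∞]`). -/
noncomputable def extLeft (f : ℝ≥0 → ℝ) (x : ℝ≥0∞) : ℝ≥0∞ :=
  ⨆ s ∈ {s : ℝ≥0 | (s : ℝ≥0∞) < x}, ENNReal.ofReal (f s)

/-- `τ²(v) = inf{t : f²²(t−) = −v}` (with `inf ∅ = ∞`), where `f22m` is the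
left-limit function of `f²²` and the argument `v ∈ [0,∞]` is interpreted in the
extended reals (so `τ²(∞) = ∞`). -/
noncomputable def tauTwo (f22m : ℝ≥0 → ℝ) (v : ℝ≥0∞) : ℝ≥0∞ :=
  sInf ((fun t : ℝ≥0 => (t : ℝ≥0∞)) ''
    {t : ℝ≥0 | ((f22m t : ℝ) : EReal) = -(v : EReal)})

theorem exists_coe_of_ne_top {x : ℝ≥0∞} (h : x ≠ ⊤) : ∃ t : ℝ≥0, (t : ℝ≥0∞) = x :=
  ⟨x.toNNReal, ENNReal.coe_toNNReal h⟩

structure GoodPath (f : ℝ≥0 → ℝ) : Prop where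
  zero : f 0 = 0
  lsc : LowerSemicontinuous f
  left : ∀ t, Tendsto f (𝓝[≤] t) (𝓝 (f t))

theorem closed_transfer (f fm : ℝ≥0 → ℝ)
    (hm : ∀ t : ℝ≥0, 0 < t → Tendsto f (𝓝[<] t) (𝓝 (fm t)))
    (C : Set ℝ) (hC : IsClosed C) (a b : ℝ≥0) (h : ∀ s, a < s → s < b → f s ∈ C) :
    ∀ s, a < s → s < b → fm s ∈ C := by
  intro s has hsb
  have hs : 0 < s := lt_of_le_of_lt (zero_le) has
  have : (𝓝[<] s).NeBot := nhdsLT_neBot_of_exists_lt ⟨a, has⟩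
  refine hC.mem_of_tendsto (hm s hs) ?_
  filter_upwards [Ioo_mem_nhdsLT has] with x hx
  exact h x hx.1 (hx.2.trans hsb)

theorem goodPath_of (f fm : ℝ≥0 → ℝ) (h0 : f 0 = 0) (hm0 : fm 0 = f 0)
    (hrc : ∀ t, ContinuousWithinAt f (Ici t) t)
    (hm : ∀ t : ℝ≥0, 0 < t → Tendsto f (𝓝[<] t) (𝓝 (fm t)))
    (hj : ∀ t, fm t ≤ f t) : GoodPath fm := by
  have left : ∀ t, Tendsto fm (𝓝[≤] t) (𝓝 (fm t)) := by
    intro t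
    rcases eq_or_lt_of_le (zero_le : (0:ℝ≥0) ≤ t) with rfl | ht
    · have : Iic (0 : ℝ≥0) = {0} := by ext x; simp
      rw [this, nhdsWithin_singleton]
      exact tendsto_pure_nhds _ _
    · rw [(closed_nhds_basis (fm t)).tendsto_right_iff]
      rintro C ⟨hC, hCc⟩
      have := hm t ht hC
      rw [Filter.mem_map, mem_nhdsLT_iff_exists_Ioo_subset' ht] at this
      obtain ⟨a, ha, hsub⟩ := this
      have key := closed_transfer f fm hm C hCc a t (fun s h1 h2 => hsub ⟨h1, h2⟩)
      filter_upwards [Ioc_mem_nhdsLE ha] with x hx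
      rcases eq_or_lt_of_le hx.2 with rfl | hlt
      · exact mem_of_mem_nhds hC
      · exact key x hx.1 hlt
  refine ⟨by rw [hm0, h0], ?_, left⟩
  intro t y hy
  obtain ⟨y', h1, h2⟩ := exists_between hy
  have hL : ∀ᶠ x in 𝓝[≤] t, y < fm x := (left t).eventually (lt_mem_nhds hy)
  have hR : ∀ᶠ x in 𝓝[>] t, y < fm x := by
    have := (hrc t).eventually (lt_mem_nhds (h2.trans_le (hj t)))
    have hex : t < t + 1 := by simp
    have : {x | y' < f x} ∈ 𝓝[≥] t := this
    rw [mem_nhdsGE_iff_exists_Ico_subset' hex] at this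
    obtain ⟨b, hb, hsub⟩ := this
    have key := closed_transfer f fm hm (Ici y') isClosed_Ici t b
      (fun s h1 h2 => mem_Ici.2 (le_of_lt (show y' < f s from hsub ⟨h1.le, h2⟩)))
    filter_upwards [Ioo_mem_nhdsGT hb] with x hx
    exact h1.trans_le (key x hx.1 hx.2)
  rw [← nhdsLE_sup_nhdsGT]
  exact Filter.eventually_sup.2 ⟨hL, hR⟩

theorem GoodPath.hit {f : ℝ≥0 → ℝ} (hf : GoodPath f) (c : ℝ) (hc : 0 ≤ c) (t : ℝ≥0)
    (ht : f t ≤ -c) : ∃ s ≤ t, f s = -c ∧ ∀ x, f x ≤ -c → s ≤ x := by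
  have hcl : IsClosed {x | f x ≤ -c} := hf.lsc.isClosed_preimage (-c)
  have hmem := hcl.csInf_mem ⟨t, ht⟩ (OrderBot.bddBelow _)
  set s := sInf {x | f x ≤ -c} with hs
  have hle : ∀ x, f x ≤ -c → s ≤ x := fun x hx => csInf_le (OrderBot.bddBelow _) hx
  refine ⟨s, hle t ht, le_antisymm hmem ?_, hle⟩
  rcases eq_or_lt_of_le (zero_le : (0:ℝ≥0) ≤ s) with h0 | h0
  · rw [← h0, hf.zero]; linarith
  · have : (𝓝[<] s).NeBot := nhdsLT_neBot_of_exists_lt ⟨0, h0⟩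
    refine ge_of_tendsto ((hf.left s).mono_left (nhdsWithin_mono _ Iio_subset_Iic_self)) ?_
    filter_upwards [self_mem_nhdsWithin] with x hx
    by_contra hcon
    exact absurd (hle x (not_le.1 hcon).le) (not_le.2 hx)

theorem coe_eq_neg_iff (a : ℝ) (v : ℝ≥0) :
    ((a : ℝ) : EReal) = -((v : ℝ≥0∞) : EReal) ↔ a = -(v : ℝ) := by
  have : ((v : ℝ≥0∞) : EReal) = ((v : ℝ) : EReal) := rfl
  rw [this]; norm_cast

theorem coe_le_neg_iff (a : ℝ) (v : ℝ≥0) :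
    ((a : ℝ) : EReal) ≤ -((v : ℝ≥0∞) : EReal) ↔ a ≤ -(v : ℝ) := by
  have : ((v : ℝ≥0∞) : EReal) = ((v : ℝ) : EReal) := rfl
  rw [this]; norm_cast

theorem GoodPath.tau_le {f : ℝ≥0 → ℝ} (hf : GoodPath f) (v : ℝ≥0∞) (t : ℝ≥0)
    (h : ((f t : ℝ) : EReal) ≤ -(v : EReal)) : tauTwo f v ≤ t := by
  induction v with
  | top => simp at h
  | coe v =>
    rw [coe_le_neg_iff] at h
    obtain ⟨s, hst, hs, -⟩ := hf.hit v v.2 t h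
    have h1 : tauTwo f v ≤ s := sInf_le ⟨s, (coe_eq_neg_iff _ _).2 hs, rfl⟩
    exact h1.trans (ENNReal.coe_le_coe.2 hst)

theorem GoodPath.attain {f : ℝ≥0 → ℝ} (hf : GoodPath f) (v : ℝ≥0∞) (t : ℝ≥0)
    (h : tauTwo f v = t) : ((f t : ℝ) : EReal) = -(v : EReal) := by
  have hne : ((fun t : ℝ≥0 => (t : ℝ≥0∞)) ''
    {t : ℝ≥0 | ((f t : ℝ) : EReal) = -(v : EReal)}).Nonempty := by
    by_contra hcon
    rw [not_nonempty_iff_eq_empty] at hcon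
    rw [tauTwo, hcon] at h
    simp at h
  obtain ⟨_, x, hx, rfl⟩ := hne
  induction v with
  | top => simp at hx
  | coe v =>
    have hx' := (coe_eq_neg_iff _ _).1 hx
    obtain ⟨s, hst, hs, hmin⟩ := hf.hit v v.2 x hx'.le
    have : tauTwo f v = s := by
      apply le_antisymm
      · exact hf.tau_le _ _ ((coe_le_neg_iff _ _).2 hs.le)
      · refine le_sInf ?_
        rintro _ ⟨y, hy, rfl⟩
        exact ENNReal.coe_le_coe.2 (hmin y ((coe_eq_neg_iff _ _).1 hy).le)
    rw [this] at h
    obtain rfl : s = t := by exact_mod_cast h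
    exact (coe_eq_neg_iff _ _).2 hs

theorem GoodPath.tau_mono {f : ℝ≥0 → ℝ} (hf : GoodPath f) : Monotone (tauTwo f) := by
  intro v w hvw
  refine le_sInf ?_
  rintro _ ⟨y, hy, rfl⟩
  refine hf.tau_le _ _ ?_
  have hy' : ((f y : ℝ) : EReal) = -(w : EReal) := hy
  rw [hy', EReal.neg_le_neg_iff]
  exact_mod_cast hvw

theorem GoodPath.tau_iSup {f : ℝ≥0 → ℝ} (hf : GoodPath f) (w : ℕ → ℝ≥0∞) (hw : Monotone w) :
    ⨆ n, tauTwo f (w n) = tauTwo f (⨆ n, w n) := by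
  apply le_antisymm
  · exact iSup_le fun n => hf.tau_mono (le_iSup w n)
  · by_cases htop : ⨆ n, tauTwo f (w n) = ⊤
    · rw [htop]; exact le_top
    obtain ⟨T, hT⟩ := exists_coe_of_ne_top htop
    have hle : ∀ n, tauTwo f (w n) ≤ T := fun n => hT ▸ le_iSup (fun n => tauTwo f (w n)) n
    have hfin : ∀ n, ∃ t : ℝ≥0, (t : ℝ≥0∞) = tauTwo f (w n) := fun n =>
      exists_coe_of_ne_top (ne_top_of_le_ne_top ENNReal.coe_ne_top (hle n))
    choose t ht using hfin
    have h1 : Tendsto (fun n => tauTwo f (w n)) atTop (𝓝 (T : ℝ≥0∞)) := by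
      rw [hT]; exact tendsto_atTop_iSup (hf.tau_mono.comp hw)
    have h2 : Tendsto t atTop (𝓝 T) := by
      simp_rw [← ht] at h1
      exact ENNReal.tendsto_coe.1 h1
    have h3 : Tendsto t atTop (𝓝[≤] T) := by
      refine tendsto_nhdsWithin_iff.2 ⟨h2, Eventually.of_forall fun n => ?_⟩
      have := hle n
      rw [← ht] at this
      exact ENNReal.coe_le_coe.1 this
    have h4 : Tendsto (fun n => f (t n)) atTop (𝓝 (f T)) := (hf.left T).comp h3
    rw [← hT]
    refine hf.tau_le _ _ ?_
    have h5 : Tendsto (fun n => ((f (t n) : ℝ) : EReal)) atTop (𝓝 ((f T : ℝ) : EReal)) :=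
      (continuous_coe_real_ereal.tendsto _).comp h4
    have h6 : Tendsto (fun n => -((w n : ℝ≥0∞) : EReal)) atTop
        (𝓝 (-((⨆ n, w n : ℝ≥0∞) : EReal))) :=
      (continuous_neg.tendsto _).comp
        ((continuous_coe_ennreal_ereal.tendsto _).comp (tendsto_atTop_iSup hw))
    have h7 : (fun n => ((f (t n) : ℝ) : EReal)) = fun n => -((w n : ℝ≥0∞) : EReal) :=
      funext fun n => hf.attain _ _ (ht n).symm
    rw [h7] at h5
    exact (tendsto_nhds_unique h5 h6).le

theorem extLeft_mono (f : ℝ≥0 → ℝ) : Monotone (extLeft f) := by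
  intro x y hxy
  exact biSup_mono fun s hs => lt_of_lt_of_le hs hxy

theorem extLeft_iSup (f : ℝ≥0 → ℝ) (x : ℕ → ℝ≥0∞) :
    extLeft f (⨆ n, x n) = ⨆ n, extLeft f (x n) := by
  apply le_antisymm
  · refine iSup₂_le fun s hs => ?_
    obtain ⟨n, hn⟩ := lt_iSup_iff.1 (show (s : ℝ≥0∞) < ⨆ n, x n from hs)
    refine le_trans ?_ (le_iSup _ n)
    exact le_iSup₂ (f := fun (s : ℝ≥0) (_ : s ∈ {s : ℝ≥0 | (s : ℝ≥0∞) < x n}) =>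
      ENNReal.ofReal (f s)) s hn
  · exact iSup_le fun n => extLeft_mono f (le_iSup x n)

theorem shift_eq_iff (a r : ℝ) (hr : 0 < r) (e : ℝ≥0∞) :
    ((a : ℝ) : EReal) + (e : EReal) = ((-r : ℝ) : EReal) ↔
      ((a : ℝ) : EReal) = -((ENNReal.ofReal r + e : ℝ≥0∞) : EReal) := by
  induction e with
  | top =>
    simp only [EReal.coe_ennreal_top, add_top, EReal.neg_top, EReal.coe_ne_bot, iff_false,
      EReal.coe_add_top]
    exact (EReal.coe_ne_top _).symm
  | coe e =>
    have h1 : (ENNReal.ofReal r + (e : ℝ≥0∞) : ℝ≥0∞) = ((r.toNNReal + e : ℝ≥0) : ℝ≥0∞) := by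
      rw [ENNReal.ofReal]; push_cast; rfl
    have h2 : ((e : ℝ≥0∞) : EReal) = ((e : ℝ) : EReal) := rfl
    rw [h1, coe_eq_neg_iff, h2, NNReal.coe_add, Real.coe_toNNReal r hr.le]
    rw [← EReal.coe_add, EReal.coe_eq_coe_iff]
    constructor <;> intro h <;> linarith

theorem first_hitting_time_single_process_representation
    -- the four càdlàg fields, with the left limits of the diagonal entries given by
    -- `f11m`, `f22m`
    (f11 f22 f12 f21 : ℝ≥0 → ℝ) (f11m f22m : ℝ≥0 → ℝ)
    (h110 : f11 0 = 0) (h220 : f22 0 = 0) (h120 : f12 0 = 0) (h210 : f21 0 = 0)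
    -- off-diagonal entries are nondecreasing (hence nonnegative) and right continuous
    (h12mono : Monotone f12) (h21mono : Monotone f21)
    (h12rc : ∀ t, ContinuousWithinAt f12 (Ici t) t)
    (h21rc : ∀ t, ContinuousWithinAt f21 (Ici t) t)
    -- diagonal entries are càdlàg, `f11m`, `f22m` are their left-limit functions
    (h11rc : ∀ t, ContinuousWithinAt f11 (Ici t) t)
    (h22rc : ∀ t, ContinuousWithinAt f22 (Ici t) t)
    (h11m0 : f11m 0 = f11 0) (h22m0 : f22m 0 = f22 0)
    (h11m : ∀ t : ℝ≥0, 0 < t → Tendsto f11 (𝓝[<] t) (𝓝 (f11m t)))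
    (h22m : ∀ t : ℝ≥0, 0 < t → Tendsto f22 (𝓝[<] t) (𝓝 (f22m t)))
    -- `f^{i,i}(t) ≥ f^{i,i}(t−)`
    (h11jump : ∀ t, f11m t ≤ f11 t) (h22jump : ∀ t, f22m t ≤ f22 t)
    -- the vector `r⃗ = (r, 0)` with `r > 0`
    (r : ℝ) (hr : 0 < r)
    -- the iteration `u⁽⁰⁾ = (0,0)`, `u⁽ⁿ⁾` as in the construction of first hitting times
    (u : ℕ → ℝ≥0∞ × ℝ≥0∞)
    (hu0 : u 0 = (0, 0))
    (hu1 : ∀ n : ℕ, (u (n + 1)).1 =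
      sInf ((fun t : ℝ≥0 => (t : ℝ≥0∞)) ''
        {t : ℝ≥0 | ((f11m t : ℝ) : EReal) + ((extLeft f12 ((u n).2) : ℝ≥0∞) : EReal)
            = ((-r : ℝ) : EReal)}))
    (hu2 : ∀ n : ℕ, (u (n + 1)).2 = tauTwo f22m (extLeft f21 ((u n).1)))
    -- the iteration is componentwise nondecreasing
    (hmono1 : Monotone fun n => (u n).1) (hmono2 : Monotone fun n => (u n).2)
    -- `T = lim_n u⁽ⁿ⁾` (the monotone limit, i.e. the supremum)
    (T1 T2 : ℝ≥0∞) (hT1 : T1 = ⨆ n, (u n).1) (hT2 : T2 = ⨆ n, (u n).2) :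
    -- conclusion: `T₁ = inf{t : f¹¹(t−) + f¹²_−(τ²(f²¹(t−))) = −r}` and
    -- `T₂ = τ²(f²¹(T₁−))`
    T1 = sInf ((fun t : ℝ≥0 => (t : ℝ≥0∞)) ''
        {t : ℝ≥0 | ((f11m t : ℝ) : EReal) +
            ((extLeft f12 (tauTwo f22m (extLeft f21 (t : ℝ≥0∞))) : ℝ≥0∞) : EReal)
            = ((-r : ℝ) : EReal)}) ∧
      T2 = tauTwo f22m (extLeft f21 T1) := by
  have g1 := goodPath_of f11 f11m h110 h11m0 h11rc h11m h11jump
  have g2 := goodPath_of f22 f22m h220 h22m0 h22rc h22m h22jump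
  have hu1' : ∀ n, (u (n + 1)).1 =
      tauTwo f11m (ENNReal.ofReal r + extLeft f12 ((u n).2)) := by
    intro n
    rw [hu1 n, tauTwo]
    simp only [shift_eq_iff _ r hr]
  simp only [shift_eq_iff _ r hr]
  have e2 : T2 = tauTwo f22m (extLeft f21 T1) := by
    rw [hT2, ← hmono2.iSup_nat_add 1]
    simp only [hu2]
    rw [g2.tau_iSup (fun n => extLeft f21 (u n).1) ((extLeft_mono f21).comp hmono1), hT1, extLeft_iSup]
  have e1 : T1 = tauTwo f11m (ENNReal.ofReal r + extLeft f12 T2) := by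
    rw [hT1, ← hmono1.iSup_nat_add 1]
    simp only [hu1']
    rw [g1.tau_iSup _ (fun a b hab => add_le_add le_rfl (extLeft_mono f12 (hmono2 hab))),
      hT2, extLeft_iSup, ENNReal.add_iSup]
  refine ⟨le_antisymm ?_ ?_, e2⟩
  · refine le_sInf ?_
    rintro _ ⟨t, ht, rfl⟩
    have ht' : ((f11m t : ℝ) : EReal) = -((ENNReal.ofReal r +
      extLeft f12 (tauTwo f22m (extLeft f21 (t : ℝ≥0∞))) : ℝ≥0∞) : EReal) := ht
    have key : ∀ n, (u n).1 ≤ t ∧ (u n).2 ≤ tauTwo f22m (extLeft f21 (t : ℝ≥0∞)) := by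
      intro n
      induction n with
      | zero => simp [hu0]
      | succ n ih =>
        refine ⟨?_, ?_⟩
        · rw [hu1']
          refine g1.tau_le _ _ ?_
          rw [ht', EReal.neg_le_neg_iff, EReal.coe_ennreal_le_coe_ennreal_iff]
          exact add_le_add le_rfl (extLeft_mono f12 ih.2)
        · rw [hu2]
          exact g2.tau_mono (extLeft_mono f21 ih.1)
    rw [hT1]
    exact iSup_le fun n => (key n).1
  · by_cases htop : T1 = ⊤
    · rw [htop]; exact le_top
    obtain ⟨t, ht⟩ := exists_coe_of_ne_top htop
    have h := g1.attain _ t (e1.symm.trans ht.symm)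
    rw [e2, ← ht] at h
    rw [← ht]
    exact sInf_le ⟨t, h, rfl⟩
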